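/- Let f be a continuous real function on an interval I ⊆ ℝ with 0 ∈ I. Then f is operator convex on I and f(0) ≤ 0 if and only if f(a* x a) ≤ a* f(x) a for every bounded self-adjoint operator x on a complex Hilbert space H with spectrum contained in I and every contraction a on H (i.e., a* a ≤ 1). -/

import Mathlib

/-- A continuous real function `f` on an interval `I ⊆ ℝ` is *operator convex on `I`* if
`f(λx + (1−λ)y) ≤ λ f(x) + (1−λ) f(y)` in the Loewner order, for every `λ ∈ [0,1]` and every
pair of bounded self-adjoint operators `x, y` on an infinite-dimensional complex Hilbert space
with spectra contained in `I`; here `f(x)` is given by the continuous functional calculus. -/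
def OperatorConvexOn (f : ℝ → ℝ) (I : Set ℝ) : Prop :=
  ∀ (H : Type) [NormedAddCommGroup H] [InnerProductSpace ℂ H] [CompleteSpace H],
    ¬ FiniteDimensional ℂ H →
      ∀ x y : H →L[ℂ] H, IsSelfAdjoint x → IsSelfAdjoint y →
        spectrum ℝ x ⊆ I → spectrum ℝ y ⊆ I →
          ∀ t : ℝ, t ∈ Set.Icc (0 : ℝ) 1 →
            cfc f (t • x + (1 - t) • y) ≤ t • cfc f x + (1 - t) • cfc f y

section JensenAux

open ContinuousLinearMap

/-- Congruence by a bounded operator between Hilbert spaces preserves the Loewner order. -/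
theorem ContinuousLinearMap.adjoint_conj_mono {H K : Type*}
    [NormedAddCommGroup H] [InnerProductSpace ℂ H] [CompleteSpace H]
    [NormedAddCommGroup K] [InnerProductSpace ℂ K] [CompleteSpace K]
    {A B : H →L[ℂ] H} (h : A ≤ B) (T : K →L[ℂ] H) :
    adjoint T ∘L A ∘L T ≤ adjoint T ∘L B ∘L T := by
  rw [le_def] at h ⊢
  convert h.adjoint_conj T using 1
  ext k
  simp

theorem IsSelfAdjoint.spectrum_subset_Icc_iff {H : Type*}
    [NormedAddCommGroup H] [InnerProductSpace ℂ H] [CompleteSpace H]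
    {x : H →L[ℂ] H} (hx : IsSelfAdjoint x) {m M : ℝ} :
    spectrum ℝ x ⊆ Set.Icc m M ↔ m • (1 : H →L[ℂ] H) ≤ x ∧ x ≤ M • (1 : H →L[ℂ] H) := by
  rw [← Algebra.algebraMap_eq_smul_one, ← Algebra.algebraMap_eq_smul_one,
    algebraMap_le_iff_le_spectrum hx, le_algebraMap_iff_spectrum_le hx]
  exact ⟨fun h => ⟨fun r hr => (h hr).1, fun r hr => (h hr).2⟩, fun h r hr => ⟨h.1 r hr, h.2 r hr⟩⟩

/-- A compact subset of an interval containing `0` lies in a compact subinterval containing `0`. -/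
theorem IsCompact.exists_subset_Icc_of_ordConnected {s I : Set ℝ} (hs : IsCompact s)
    (hI : I.OrdConnected) (h0 : (0 : ℝ) ∈ I) (hsI : s ⊆ I) :
    ∃ m M : ℝ, m ≤ 0 ∧ 0 ≤ M ∧ s ⊆ Set.Icc m M ∧ Set.Icc m M ⊆ I := by
  have hc : IsCompact (insert 0 s) := hs.insert 0
  have hne : (insert (0 : ℝ) s).Nonempty := ⟨0, by simp⟩
  have hsub : insert 0 s ⊆ I := Set.insert_subset h0 hsI
  have hle : insert 0 s ⊆ Set.Icc (sInf (insert 0 s)) (sSup (insert 0 s)) := fun r hr =>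
    ⟨csInf_le hc.bddBelow hr, le_csSup hc.bddAbove hr⟩
  exact ⟨_, _, (hle (by simp)).1, (hle (by simp)).2, (Set.subset_insert _ _).trans hle,
    hI.out (hsub (hc.sInf_mem hne)) (hsub (hc.sSup_mem hne))⟩

theorem norm_cfc_sub_aeval_le {H : Type*}
    [NormedAddCommGroup H] [InnerProductSpace ℂ H] [CompleteSpace H]
    {f : ℝ → ℝ} {s : Set ℝ} (hf : ContinuousOn f s) {x : H →L[ℂ] H} (hx : IsSelfAdjoint x)
    (hxs : spectrum ℝ x ⊆ s) {ε : ℝ} (hε : 0 ≤ ε) {p : Polynomial ℝ}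
    (hp : ∀ r ∈ s, |p.eval r - f r| ≤ ε) :
    ‖cfc f x - Polynomial.aeval x p‖ ≤ ε := by
  rw [← cfc_polynomial p x hx, ← cfc_sub f (fun r => p.eval r) x (hf.mono hxs)
    p.continuous.continuousOn]
  refine norm_cfc_le hε fun r hr => ?_
  rw [Real.norm_eq_abs, abs_sub_comm]
  exact hp r (hxs hr)

/-- The continuous functional calculus respects intertwining operators between Hilbert spaces. -/
theorem cfc_comp_eq_comp_cfc {H K : Type*}
    [NormedAddCommGroup H] [InnerProductSpace ℂ H] [CompleteSpace H]
    [NormedAddCommGroup K] [InnerProductSpace ℂ K] [CompleteSpace K]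
    {f : ℝ → ℝ} {m M : ℝ} (hf : ContinuousOn f (Set.Icc m M))
    {x : H →L[ℂ] H} {y : K →L[ℂ] K} (hx : IsSelfAdjoint x) (hy : IsSelfAdjoint y)
    (hxs : spectrum ℝ x ⊆ Set.Icc m M) (hys : spectrum ℝ y ⊆ Set.Icc m M)
    {T : H →L[ℂ] K} (h : y ∘L T = T ∘L x) :
    cfc f y ∘L T = T ∘L cfc f x := by
  have hpoly (p : Polynomial ℝ) : Polynomial.aeval y p ∘L T = T ∘L Polynomial.aeval x p := by
    induction p using Polynomial.induction_on' with
    | add p q hp hq => simp [hp, hq]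
    | monomial n r =>
      have hpow : ∀ n : ℕ, (y ^ n) ∘L T = T ∘L (x ^ n) := by
        intro n
        induction n with
        | zero => ext; simp
        | succ n ih =>
          ext k
          have h1 := congr($h k)
          have h2 := congr($ih (x k))
          simp only [comp_apply] at h1 h2
          simp [pow_succ, h1, h2]
      ext k
      have h3 := congr($(hpow n) k)
      simp only [comp_apply] at h3
      simp [Polynomial.aeval_monomial, Algebra.algebraMap_eq_smul_one, h3]
  rw [← sub_eq_zero, ← norm_le_zero_iff]
  refine le_of_forall_pos_le_add fun ε hε => ?_
  obtain ⟨δ, hδ0, hδ⟩ : ∃ δ > 0, 2 * (‖T‖ + 1) * δ = ε :=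
    ⟨ε / (2 * (‖T‖ + 1)), by positivity, mul_div_cancel₀ _ (by positivity)⟩
  obtain ⟨p, hp⟩ := exists_polynomial_near_of_continuousOn m M f hf δ hδ0
  have hsplit : cfc f y ∘L T - T ∘L cfc f x =
      (cfc f y - Polynomial.aeval y p) ∘L T - T ∘L (cfc f x - Polynomial.aeval x p) := by
    rw [sub_comp, comp_sub, hpoly]
    abel
  rw [hsplit]
  calc _ ≤ δ * ‖T‖ + ‖T‖ * δ := by
        refine (norm_sub_le _ _).trans (add_le_add ?_ ?_)
        · refine (opNorm_comp_le _ _).trans ?_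
          gcongr
          exact norm_cfc_sub_aeval_le hf hy hys hδ0.le fun r hr => (hp r hr).le
        · refine (opNorm_comp_le _ _).trans ?_
          gcongr
          exact norm_cfc_sub_aeval_le hf hx hxs hδ0.le fun r hr => (hp r hr).le
    _ ≤ 2 * (‖T‖ + 1) * δ := by nlinarith
    _ = 0 + ε := by rw [hδ, zero_add]

/-- Compressing by a contraction keeps the spectrum in an interval containing `0`. -/
theorem IsSelfAdjoint.spectrum_adjoint_conj_subset_Icc {H K : Type*}
    [NormedAddCommGroup H] [InnerProductSpace ℂ H] [CompleteSpace H]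
    [NormedAddCommGroup K] [InnerProductSpace ℂ K] [CompleteSpace K]
    {x : H →L[ℂ] H} (hx : IsSelfAdjoint x) {m M : ℝ} (hm : m ≤ 0) (hM : 0 ≤ M)
    (hxs : spectrum ℝ x ⊆ Set.Icc m M) {c : K →L[ℂ] H} (hc : adjoint c ∘L c ≤ 1) :
    spectrum ℝ (adjoint c ∘L x ∘L c) ⊆ Set.Icc m M := by
  obtain ⟨h1, h2⟩ := hx.spectrum_subset_Icc_iff.1 hxs
  have hsmul (r : ℝ) : adjoint c ∘L (r • (1 : H →L[ℂ] H)) ∘L c = r • (adjoint c ∘L c) := by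
    ext k
    simp
  refine (hx.adjoint_conj c).spectrum_subset_Icc_iff.2 ⟨?_, ?_⟩
  · refine le_trans ?_ (adjoint_conj_mono h1 c)
    rw [hsmul]
    exact smul_le_smul_of_nonpos_left hc hm
  · refine (adjoint_conj_mono h2 c).trans ?_
    rw [hsmul]
    exact smul_le_smul_of_nonneg_left hc hM

/-- `u` and `v` are isometries with orthogonal ranges that together exhibit `K` as the Hilbert
space direct sum of `H` and `L`. -/
structure IsDirectSumPair {H L K : Type*}
    [NormedAddCommGroup H] [InnerProductSpace ℂ H] [CompleteSpace H]
    [NormedAddCommGroup L] [InnerProductSpace ℂ L] [CompleteSpace L]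
    [NormedAddCommGroup K] [InnerProductSpace ℂ K] [CompleteSpace K]
    (u : H →L[ℂ] K) (v : L →L[ℂ] K) : Prop where
  adjoint_left_left (h : H) : adjoint u (u h) = h
  adjoint_left_right (l : L) : adjoint u (v l) = 0
  adjoint_right_left (h : H) : adjoint v (u h) = 0
  adjoint_right_right (l : L) : adjoint v (v l) = l
  comp_adjoint_add : u ∘L adjoint u + v ∘L adjoint v = 1

section DirectSum

variable {H L K : Type*} [NormedAddCommGroup H] [InnerProductSpace ℂ H] [CompleteSpace H]
    [NormedAddCommGroup L] [InnerProductSpace ℂ L] [CompleteSpace L]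
    [NormedAddCommGroup K] [InnerProductSpace ℂ K] [CompleteSpace K]

theorem IsDirectSumPair.comp_adjoint_le_one {u : H →L[ℂ] K} {v : L →L[ℂ] K}
    (h : IsDirectSumPair u v) : u ∘L adjoint u ≤ 1 := by
  rw [← h.comp_adjoint_add]
  refine le_add_of_nonneg_right ?_
  rw [nonneg_iff_isPositive]
  exact isPositive_self_comp_adjoint _

theorem IsDirectSumPair.not_finiteDimensional {u : H →L[ℂ] K} {v : L →L[ℂ] K}
    (h : IsDirectSumPair u v) (hL : ¬ FiniteDimensional ℂ L) : ¬ FiniteDimensional ℂ K := by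
  intro hfin
  refine hL (FiniteDimensional.of_injective v.toLinearMap fun a b hab => ?_)
  rw [← h.adjoint_right_right a, ← h.adjoint_right_right b]
  exact congr(adjoint v $hab)

variable (H L) in
theorem exists_isDirectSumPair_withLp :
    ∃ (u : H →L[ℂ] WithLp 2 (H × L)) (v : L →L[ℂ] WithLp 2 (H × L)), IsDirectSumPair u v := by
  let e := (WithLp.prodContinuousLinearEquiv 2 ℂ H L).symm.toContinuousLinearMap
  have hu : adjoint (e ∘L .inl ℂ H L) = WithLp.fstL 2 ℂ H L := by
    symm
    rw [eq_adjoint_iff]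
    intro k h
    simp [e, WithLp.prod_inner_apply]
  have hv : adjoint (e ∘L .inr ℂ H L) = WithLp.sndL 2 ℂ H L := by
    symm
    rw [eq_adjoint_iff]
    intro k h
    simp [e, WithLp.prod_inner_apply]
  refine ⟨e ∘L .inl ℂ H L, e ∘L .inr ℂ H L, ?_, ?_, ?_, ?_, ?_⟩ <;> simp only [hu, hv]
  · simp [e]
  · simp [e]
  · simp [e]
  · simp [e]
  · ext k
    apply (WithLp.prodContinuousLinearEquiv 2 ℂ H L).injective
    simp [e]
    rfl

end DirectSum

theorem not_finiteDimensional_lp_nat : ¬ FiniteDimensional ℂ (lp (fun _ : ℕ => ℂ) 2) := by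
  intro h
  let b : HilbertBasis ℕ ℂ (lp (fun _ : ℕ => ℂ) 2) := ⟨LinearIsometryEquiv.refl ℂ _⟩
  have := b.orthonormal.linearIndependent.finite
  exact not_finite ℕ

/-- Jensen's operator inequality for compressions by an isometry into an infinite-dimensional
Hilbert space. -/
theorem OperatorConvexOn.cfc_isometry_conj_le {f : ℝ → ℝ} {I : Set ℝ} (hconv : OperatorConvexOn f I)
    (hI : I.OrdConnected) (hf : ContinuousOn f I) (h0 : (0 : ℝ) ∈ I) {H K : Type}
    [NormedAddCommGroup H] [InnerProductSpace ℂ H] [CompleteSpace H]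
    [NormedAddCommGroup K] [InnerProductSpace ℂ K] [CompleteSpace K]
    (hK : ¬ FiniteDimensional ℂ K) {x : K →L[ℂ] K} (hx : IsSelfAdjoint x)
    (hxI : spectrum ℝ x ⊆ I) {w : H →L[ℂ] K} (hw : adjoint w ∘L w = 1) :
    cfc f (adjoint w ∘L x ∘L w) ≤ adjoint w ∘L cfc f x ∘L w := by
  obtain ⟨m, M, hm, hM, hxs, hmM⟩ :=
    (spectrum.isCompact (𝕜 := ℝ) x).exists_subset_Icc_of_ordConnected hI h0 hxI
  replace hf := hf.mono hmM
  have hww (h : H) : adjoint w (w h) = h := congr($hw h)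
  set s : K →L[ℂ] K := (2 : ℝ) • (w ∘L adjoint w) - 1 with hs
  have hsapp (k : K) : s k = (2 : ℝ) • w (adjoint w k) - k := by simp [hs]
  have hs_adj : adjoint s = s := by
    have h1 : IsSelfAdjoint (w ∘L adjoint w) := (isPositive_self_comp_adjoint w).isSelfAdjoint
    exact ((IsSelfAdjoint.all (2 : ℝ)).smul h1).sub (.one _)
  have hss (k : K) : s (s k) = k := by
    simp only [hsapp, map_sub, ContinuousLinearMap.map_smul_of_tower, hww]
    module
  have hsw (h : H) : s (w h) = w h := by
    simp only [hsapp, hww]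
    module
  have hws (k : K) : adjoint w (s k) = adjoint w k := by
    simp only [hsapp, map_sub, ContinuousLinearMap.map_smul_of_tower, hww]
    module
  set z := adjoint s ∘L x ∘L s with hz
  have hz_sa : IsSelfAdjoint z := hx.adjoint_conj s
  have hzs : spectrum ℝ z ⊆ Set.Icc m M := by
    refine hx.spectrum_adjoint_conj_subset_Icc hm hM hxs (le_of_eq ?_)
    ext k
    simp [hs_adj, hss]
  set y := (1 / 2 : ℝ) • x + (1 - 1 / 2 : ℝ) • z with hy
  have hy_sa : IsSelfAdjoint y :=
    ((IsSelfAdjoint.all _).smul hx).add ((IsSelfAdjoint.all _).smul hz_sa)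
  have hys : spectrum ℝ y ⊆ Set.Icc m M := by
    obtain ⟨h1, h2⟩ := hx.spectrum_subset_Icc_iff.1 hxs
    obtain ⟨h3, h4⟩ := hz_sa.spectrum_subset_Icc_iff.1 hzs
    refine hy_sa.spectrum_subset_Icc_iff.2 ⟨?_, ?_⟩
    · exact convex_Ici (𝕜 := ℝ) _ (Set.mem_Ici.2 h1) (Set.mem_Ici.2 h3) (by norm_num) (by norm_num)
        (by norm_num)
    · exact convex_Iic (𝕜 := ℝ) _ (Set.mem_Iic.2 h2) (Set.mem_Iic.2 h4) (by norm_num) (by norm_num)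
        (by norm_num)
  have hkey := hconv K hK x z hx hz_sa hxI (hzs.trans hmM) (1 / 2) (by norm_num)
  rw [← hy] at hkey
  have hyw : cfc f y ∘L w = w ∘L cfc f (adjoint w ∘L x ∘L w) := by
    refine cfc_comp_eq_comp_cfc hf (hx.adjoint_conj w) hy_sa
      (hx.spectrum_adjoint_conj_subset_Icc hm hM hxs hw.le) hys ?_
    ext h
    simp only [hy, hz, hs_adj, comp_apply, add_apply, smul_apply, hsw]
    rw [hsapp]
    module
  have hzS : cfc f z ∘L s = s ∘L cfc f x := by
    refine cfc_comp_eq_comp_cfc hf hx hz_sa hxs hzs ?_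
    ext k
    simp [hz, hs_adj, hss]
  convert adjoint_conj_mono hkey w using 1
  · rw [hyw]
    ext h
    simp [hww]
  · ext h
    have h1 := congr($hzS (w h))
    simp only [comp_apply, hsw] at h1
    simp only [comp_apply, add_apply, smul_apply, map_add, ContinuousLinearMap.map_smul_of_tower,
      h1, hws]
    module

/-- Jensen's operator inequality for a contraction `a` that is dilated to an isometry into an
infinite-dimensional direct sum by means of `d` with `d* d = 1 - a* a`. -/
theorem OperatorConvexOn.cfc_contraction_conj_le_of_dilation {f : ℝ → ℝ} {I : Set ℝ}
    (hconv : OperatorConvexOn f I) (hf0 : f 0 ≤ 0) (hI : I.OrdConnected) (hf : ContinuousOn f I)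
    (h0 : (0 : ℝ) ∈ I) {H L K : Type}
    [NormedAddCommGroup H] [InnerProductSpace ℂ H] [CompleteSpace H]
    [NormedAddCommGroup L] [InnerProductSpace ℂ L] [CompleteSpace L]
    [NormedAddCommGroup K] [InnerProductSpace ℂ K] [CompleteSpace K]
    (hK : ¬ FiniteDimensional ℂ K) {u : H →L[ℂ] K} {v : L →L[ℂ] K} (huv : IsDirectSumPair u v)
    {x a : H →L[ℂ] H} (hx : IsSelfAdjoint x) (hxI : spectrum ℝ x ⊆ I) (ha : star a * a ≤ 1)
    {d : H →L[ℂ] L} (hdd : ∀ h, adjoint d (d h) = h - adjoint a (a h)) :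
    cfc f (star a * x * a) ≤ star a * cfc f x * a := by
  obtain ⟨m, M, hm, hM, hxs, hmM⟩ :=
    (spectrum.isCompact (𝕜 := ℝ) x).exists_subset_Icc_of_ordConnected hI h0 hxI
  have hf' := hf.mono hmM
  set X := adjoint (adjoint u) ∘L x ∘L adjoint u with hX
  have hX_sa : IsSelfAdjoint X := hx.adjoint_conj _
  have hXs : spectrum ℝ X ⊆ Set.Icc m M := by
    refine hx.spectrum_adjoint_conj_subset_Icc hm hM hxs ?_
    rw [adjoint_adjoint]
    exact huv.comp_adjoint_le_one
  have hXu : cfc f X ∘L u = u ∘L cfc f x := by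
    refine cfc_comp_eq_comp_cfc hf' hx hX_sa hxs hXs ?_
    ext h
    simp [hX, huv.adjoint_left_left]
  have hXv : cfc f X ∘L v = v ∘L cfc f (0 : L →L[ℂ] L) := by
    refine cfc_comp_eq_comp_cfc hf' (IsSelfAdjoint.zero (L →L[ℂ] L)) hX_sa ?_ hXs ?_
    · refine (IsSelfAdjoint.zero (L →L[ℂ] L)).spectrum_subset_Icc_iff.2 ⟨?_, ?_⟩
      · exact smul_nonpos_of_nonpos_of_nonneg hm zero_le_one
      · exact smul_nonneg hM zero_le_one
    · ext h
      simp [hX, huv.adjoint_left_right]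
  set w := u ∘L a + v ∘L d with hw
  have hw_adj : adjoint w = adjoint a ∘L adjoint u + adjoint d ∘L adjoint v := by
    simp [hw, adjoint_comp]
  have hww : adjoint w ∘L w = 1 := by
    ext h
    rw [hw_adj]
    simp [hw, hdd, huv.adjoint_left_left, huv.adjoint_left_right, huv.adjoint_right_left,
      huv.adjoint_right_right]
  have hle := hconv.cfc_isometry_conj_le hI hf h0 hK hX_sa (hXs.trans hmM) hww
  have h1 : adjoint w ∘L X ∘L w = star a * x * a := by
    ext h
    rw [hw_adj]
    simp [hw, hX, star_eq_adjoint, huv.adjoint_left_left, huv.adjoint_left_right,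
      huv.adjoint_right_left]
  have h2 : adjoint w ∘L cfc f X ∘L w = star a * cfc f x * a + f 0 • (1 - star a * a) := by
    ext h
    have h3 := congr($hXu (a h))
    have h4 := congr($hXv (d h))
    rw [cfc_apply_zero, Algebra.algebraMap_eq_smul_one] at h4
    simp only [comp_apply] at h3 h4
    simp only [hw_adj, comp_apply]
    simp [hw, h3, h4, ContinuousLinearMap.map_smul_of_tower, hdd, star_eq_adjoint,
      huv.adjoint_left_left, huv.adjoint_left_right, huv.adjoint_right_left,
      huv.adjoint_right_right]
  rw [h1, h2] at hle
  exact hle.trans (add_le_of_nonpos_right (smul_nonpos_of_nonpos_of_nonneg hf0 (sub_nonneg.2 ha)))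

/-- Jensen's operator inequality for contractions, from operator convexity and `f 0 ≤ 0`. -/
theorem OperatorConvexOn.cfc_contraction_conj_le {f : ℝ → ℝ} {I : Set ℝ}
    (hconv : OperatorConvexOn f I) (hf0 : f 0 ≤ 0) (hI : I.OrdConnected) (hf : ContinuousOn f I)
    (h0 : (0 : ℝ) ∈ I) {H : Type}
    [NormedAddCommGroup H] [InnerProductSpace ℂ H] [CompleteSpace H]
    {x a : H →L[ℂ] H} (hx : IsSelfAdjoint x) (hxI : spectrum ℝ x ⊆ I) (ha : star a * a ≤ 1) :
    cfc f (star a * x * a) ≤ star a * cfc f x * a := by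
  obtain ⟨u, v, huv⟩ := exists_isDirectSumPair_withLp H (lp (fun _ : ℕ => ℂ) 2)
  obtain ⟨u', v', huv'⟩ := exists_isDirectSumPair_withLp H (WithLp 2 (H × lp (fun _ : ℕ => ℂ) 2))
  have hK := huv'.not_finiteDimensional (huv.not_finiteDimensional not_finiteDimensional_lp_nat)
  set c := CFC.sqrt (1 - star a * a)
  have hc_sa : adjoint c = c := (IsSelfAdjoint.of_nonneg (CFC.sqrt_nonneg _))
  have hcc (h : H) : c (c h) = h - adjoint a (a h) :=
    congr($(CFC.sqrt_mul_sqrt_self (1 - star a * a) (sub_nonneg.2 ha)) h)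
  refine hconv.cfc_contraction_conj_le_of_dilation hf0 hI hf h0 hK huv' hx hxI ha (d := u ∘L c) ?_
  intro h
  rw [adjoint_comp, hc_sa]
  simp only [comp_apply]
  rw [huv.adjoint_left_left, hcc]

set_option maxHeartbeats 1000000 in
/-- Jensen's operator inequality for contractions on `K ≅ H ⊕ H` gives the operator convexity
inequality on `H`. -/
theorem IsDirectSumPair.cfc_convexCombo_le {H K : Type*}
    [NormedAddCommGroup H] [InnerProductSpace ℂ H] [CompleteSpace H]
    [NormedAddCommGroup K] [InnerProductSpace ℂ K] [CompleteSpace K]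
    {u v : H →L[ℂ] K} (huv : IsDirectSumPair u v) {f : ℝ → ℝ} {I : Set ℝ}
    (hI : I.OrdConnected) (hf : ContinuousOn f I) (h0 : (0 : ℝ) ∈ I)
    (hjensen : ∀ x a : K →L[ℂ] K, IsSelfAdjoint x → spectrum ℝ x ⊆ I → star a * a ≤ 1 →
        cfc f (star a * x * a) ≤ star a * cfc f x * a)
    {x y : H →L[ℂ] H} (hx : IsSelfAdjoint x) (hy : IsSelfAdjoint y)
    (hxI : spectrum ℝ x ⊆ I) (hyI : spectrum ℝ y ⊆ I) {t : ℝ} (ht : t ∈ Set.Icc (0 : ℝ) 1) :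
    cfc f (t • x + (1 - t) • y) ≤ t • cfc f x + (1 - t) • cfc f y := by
  obtain ⟨m, M, hm, hM, hs, hmM⟩ :=
    ((spectrum.isCompact (𝕜 := ℝ) x).union
      (spectrum.isCompact (𝕜 := ℝ) y)).exists_subset_Icc_of_ordConnected hI h0
      (Set.union_subset hxI hyI)
  obtain ⟨hxs, hys⟩ := Set.union_subset_iff.1 hs
  have hf' := hf.mono hmM
  set X := adjoint (adjoint u) ∘L x ∘L adjoint u + adjoint (adjoint v) ∘L y ∘L adjoint v with hX
  have hX_sa : IsSelfAdjoint X := (hx.adjoint_conj _).add (hy.adjoint_conj _)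
  have hXs : spectrum ℝ X ⊆ Set.Icc m M := by
    obtain ⟨h1, h2⟩ := hx.spectrum_subset_Icc_iff.1 hxs
    obtain ⟨h3, h4⟩ := hy.spectrum_subset_Icc_iff.1 hys
    have hsmul (r : ℝ) : adjoint (adjoint u) ∘L (r • (1 : H →L[ℂ] H)) ∘L adjoint u +
        adjoint (adjoint v) ∘L (r • (1 : H →L[ℂ] H)) ∘L adjoint v = r • 1 := by
      rw [← huv.comp_adjoint_add]
      ext k
      simp
    refine hX_sa.spectrum_subset_Icc_iff.2 ⟨?_, ?_⟩
    · rw [← hsmul]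
      exact add_le_add (adjoint_conj_mono h1 _) (adjoint_conj_mono h3 _)
    · rw [← hsmul]
      exact add_le_add (adjoint_conj_mono h2 _) (adjoint_conj_mono h4 _)
  have hXu' : X ∘L u = u ∘L x := by
    ext h
    simp [hX, huv.adjoint_left_left, huv.adjoint_right_left]
  have hXu : cfc f X ∘L u = u ∘L cfc f x := by
    refine cfc_comp_eq_comp_cfc hf' hx hX_sa hxs hXs hXu'
  have hXv' : X ∘L v = v ∘L y := by
    ext h
    simp [hX, huv.adjoint_left_right, huv.adjoint_right_right]
  have hXv : cfc f X ∘L v = v ∘L cfc f y := by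
    refine cfc_comp_eq_comp_cfc hf' hy hX_sa hys hXs hXv'
  set w := √t • u + √(1 - t) • v with hw
  have hw_adj (k) : adjoint w k = √t • adjoint u k + √(1 - t) • adjoint v k := by
    have : adjoint w = √t • adjoint u + √(1 - t) • adjoint v := by
      symm
      rw [eq_adjoint_iff]
      intro k h
      simp [hw, inner_add_left, inner_add_right, adjoint_inner_left, inner_smul_left_eq_smul,
        inner_smul_right_eq_smul]
    simp [this]
  have hsum : ∀ h k : H, √t • √t • h + √(1 - t) • √(1 - t) • k = t • h + (1 - t) • k := by
    intro h k
    rw [smul_smul, smul_smul, Real.mul_self_sqrt ht.1, Real.mul_self_sqrt (sub_nonneg.2 ht.2)]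
  have hconj {A : K →L[ℂ] K} {p q : H →L[ℂ] H}
      (hp : A ∘L u = u ∘L p) (hq : A ∘L v = v ∘L q) (h : H) :
      adjoint w (A (w h)) = t • p h + (1 - t) • q h := by
    have h1 := congr($hp h)
    have h2 := congr($hq h)
    simp only [comp_apply] at h1 h2
    rw [← hsum, hw_adj]
    simp [hw, ContinuousLinearMap.map_smul_of_tower, h1, h2,
      huv.adjoint_left_left, huv.adjoint_left_right, huv.adjoint_right_left,
      huv.adjoint_right_right]
  have hww (h : H) : adjoint w (w h) = h := by
    have h1 := hconj (A := .id ℂ K) (p := .id ℂ H) (q := .id ℂ H) rfl rfl h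
    simp only [id_apply] at h1
    rw [h1]
    module
  set a := w ∘L adjoint u with ha
  have ha_adj : star a = u ∘L adjoint w := by
    rw [star_eq_adjoint, ha, adjoint_comp, adjoint_adjoint]
  have haw (k : K) : a k = w (adjoint u k) := rfl
  have haa : star a * a ≤ 1 := by
    convert huv.comp_adjoint_le_one using 1
    ext k
    simp [ha_adj, hww, haw]
  have hle := hjensen X a hX_sa (hXs.trans hmM) haa
  set Y := star a * X * a with hY
  have hY_sa : IsSelfAdjoint Y := hX_sa.conjugate' a
  have hYs : spectrum ℝ Y ⊆ Set.Icc m M :=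
    hX_sa.spectrum_adjoint_conj_subset_Icc hm hM hXs haa
  set z := t • x + (1 - t) • y with hz
  have hz_sa : IsSelfAdjoint z :=
    ((IsSelfAdjoint.all _).smul hx).add ((IsSelfAdjoint.all _).smul hy)
  have hwX (h : H) : adjoint w (X (w h)) = z h := by
    rw [hconj (p := x) (q := y) hXu' hXv']
    simp [hz]
  have hzs : spectrum ℝ z ⊆ Set.Icc m M := by
    have : z = adjoint w ∘L X ∘L w := by
      ext h
      simp [hwX]
    rw [this]
    refine hX_sa.spectrum_adjoint_conj_subset_Icc hm hM hXs (le_of_eq ?_)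
    ext h
    simp [hww]
  have hYu : cfc f Y ∘L u = u ∘L cfc f z := by
    refine cfc_comp_eq_comp_cfc hf' hz_sa hY_sa hzs hYs ?_
    ext h
    simp [hY, ha_adj, haw, hwX, huv.adjoint_left_left]
  convert adjoint_conj_mono hle u using 1
  · rw [hYu]
    ext h
    simp [huv.adjoint_left_left]
  · ext h
    simp [ha_adj, haw, hconj hXu hXv, huv.adjoint_left_left]

/-- Operator convexity from Jensen's operator inequality for contractions. -/
theorem operatorConvexOn_of_cfc_contraction_conj_le {f : ℝ → ℝ} {I : Set ℝ}
    (hI : I.OrdConnected) (hf : ContinuousOn f I) (h0 : (0 : ℝ) ∈ I)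
    (hjensen : ∀ (H : Type) [NormedAddCommGroup H] [InnerProductSpace ℂ H] [CompleteSpace H],
      ∀ x a : H →L[ℂ] H, IsSelfAdjoint x → spectrum ℝ x ⊆ I → star a * a ≤ 1 →
        cfc f (star a * x * a) ≤ star a * cfc f x * a) :
    OperatorConvexOn f I := by
  intro H _ _ _ _ x y hx hy hxI hyI t ht
  obtain ⟨u, v, huv⟩ := exists_isDirectSumPair_withLp H H
  exact huv.cfc_convexCombo_le hI hf h0 (hjensen _) hx hy hxI hyI ht

theorem apply_zero_nonpos_of_cfc_contraction_conj_le {f : ℝ → ℝ} {I : Set ℝ} (h0 : (0 : ℝ) ∈ I)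
    (hjensen : ∀ (H : Type) [NormedAddCommGroup H] [InnerProductSpace ℂ H] [CompleteSpace H],
      ∀ x a : H →L[ℂ] H, IsSelfAdjoint x → spectrum ℝ x ⊆ I → star a * a ≤ 1 →
        cfc f (star a * x * a) ≤ star a * cfc f x * a) :
    f 0 ≤ 0 := by
  have h := hjensen ℂ 0 0 (.zero _) (by simpa [spectrum.zero_eq] using h0) (by simp)
  rw [mul_zero, cfc_apply_zero, mul_zero, Algebra.algebraMap_eq_smul_one, le_def] at h
  have h1 := h.re_inner_nonneg_left 1
  simpa using h1

end JensenAux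

/-- **The original Jensen operator inequality.**  Let `f` be continuous on an interval
`I ⊆ ℝ` with `0 ∈ I`.  Then `f` is operator convex on `I` with `f(0) ≤ 0` if and only if
`f(a* x a) ≤ a* f(x) a` for every bounded self-adjoint operator `x` on a complex Hilbert
space `H` with spectrum in `I` and every contraction `a` on `H` (i.e. `a* a ≤ 1`). -/
theorem jensen_operator_inequality_contraction
    (f : ℝ → ℝ) (I : Set ℝ) (hI : I.OrdConnected) (hf : ContinuousOn f I)
    (h0 : (0 : ℝ) ∈ I) :
    (OperatorConvexOn f I ∧ f 0 ≤ 0) ↔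
      ∀ (H : Type) [NormedAddCommGroup H] [InnerProductSpace ℂ H] [CompleteSpace H],
        ∀ x a : H →L[ℂ] H, IsSelfAdjoint x → spectrum ℝ x ⊆ I → star a * a ≤ 1 →
          cfc f (star a * x * a) ≤ star a * cfc f x * a := by
  exact ⟨fun h H _ _ _ x a hx hxI ha => h.1.cfc_contraction_conj_le h.2 hI hf h0 hx hxI ha,
    fun h => ⟨operatorConvexOn_of_cfc_contraction_conj_le hI hf h0 h,
      apply_zero_nonpos_of_cfc_contraction_conj_le h0 h⟩⟩
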